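/- Let c and t be positive integers with 2c ≤ t. If t is even, then binom(c + t/2 − 1, t/2)^2 + 2^{2c−1} ≤ binom(2c + t − 1, t); if t is odd, then 2^{2c−1} ≤ binom(2c + t − 1, t). -/

import Mathlib

open scoped Classical

inductive PTree : Type
  | leaf : PTree
  | node : PTree → PTree → PTree
deriving DecidableEq

namespace PTree

def size : PTree → ℕ
  | leaf => 1
  | node l r => size l + size r

def cherries : PTree → ℕ
  | leaf => 0
  | node leaf leaf => 1
  | node l r => cherries l + cherries r

def height : PTree → ℕ
  | leaf => 0
  | node l r => max (height l) (height r) + 1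

def encode : PTree → ℕ
  | leaf => 0
  | node l r => Nat.pair (encode l) (encode r) + 1

def normalize : PTree → PTree
  | leaf => leaf
  | node l r =>
      let l' := normalize l
      let r' := normalize r
      if encode l' ≤ encode r' then node l' r' else node r' l'

def isoFuns : PTree → PTree → List (ℕ → ℕ)
  | leaf, leaf => [fun i => i]
  | node l r, node l' r' =>
      ((isoFuns l l').flatMap fun g => (isoFuns r r').map fun h =>
        fun i => if i < l.size then g i else h (i - l.size) + l'.size)
      ++
      ((isoFuns l r').flatMap fun g => (isoFuns r l').map fun h =>
        fun i => if i < l.size then g i + l'.size else h (i - l.size))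
  | _, _ => []

def planeTrees : ℕ → Finset PTree
  | 0 => ∅
  | 1 => {leaf}
  | n + 2 =>
      (Finset.range (n + 1)).attach.biUnion fun k =>
        ((planeTrees (k.1 + 1)) ×ˢ (planeTrees (n + 1 - k.1))).image
          fun p => node p.1 p.2
  termination_by n => n
  decreasing_by
  · have := Finset.mem_range.mp k.2; omega
  · omega

def binTrees (n : ℕ) : Finset PTree := (planeTrees n).image normalize

/-- Triples (T, v, S): left plane tree, right plane tree, and a matching `v`
(a permutation of `0, …, n-1`, encoded as the list of its values) matching
leaf `i` of `T` with leaf `v i` of `S`. -/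
def Triples (n : ℕ) : Finset (PTree × PTree × List ℕ) :=
  (planeTrees n) ×ˢ ((planeTrees n) ×ˢ (List.range n).permutations.toFinset)

/-- Two triples represent the same tanglegram iff there are isomorphisms of the left
trees and of the right trees compatible with the matchings. -/
def equivTriple (n : ℕ) (t t' : PTree × PTree × List ℕ) : Bool :=
  (isoFuns t.1 t'.1).any fun φ => (isoFuns t.2.1 t'.2.1).any fun ψ =>
    (List.range n).all fun i => t'.2.2.getD (φ i) 0 == ψ (t.2.2.getD i 0)

/-- The tanglegrams of size `n`: equivalence classes of triples. -/
def tangleClasses (n : ℕ) : Finset (Finset (PTree × PTree × List ℕ)) :=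
  (Triples n).image fun t => (Triples n).filter (fun t' => equivTriple n t t' = true)

/-- The number of tanglegrams of size `n`. -/
def numTanglegrams (n : ℕ) : ℕ := (tangleClasses n).card

/-- The probability that a uniformly random tanglegram of size `n` satisfies the
(isomorphism-invariant) property `P` of triples. -/
noncomputable def tangleProb (n : ℕ) (P : PTree × PTree × List ℕ → Prop) : ℝ :=
  ((tangleClasses n).filter fun c => ∃ t ∈ c, P t).card / numTanglegrams n

/-- The expectation of the statistic `f` of a uniformly random tanglegram of size `n`. -/
noncomputable def tangleExp (n : ℕ) (f : PTree × PTree × List ℕ → ℕ) : ℝ :=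
  ∑' k : ℕ, (k : ℝ) * tangleProb n (fun t => f t = k)

end PTree

namespace PTree

/-- The distribution on pairs of binary trees (canonical representatives) induced by
the two halves of a uniformly random tanglegram of size `n`:
probability that the pair of isomorphism classes of the two trees lies in `S`. -/
noncomputable def nuT (n : ℕ) (S : Finset (PTree × PTree)) : ℝ :=
  tangleProb n fun t => (normalize t.1, normalize t.2.1) ∈ S

/-- The distribution on pairs of binary trees induced by two independent uniformly
random plane binary trees with `n` leaves. -/
noncomputable def nuP (n : ℕ) (S : Finset (PTree × PTree)) : ℝ :=
  (((planeTrees n) ×ˢ (planeTrees n)).filter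
      fun p => (normalize p.1, normalize p.2) ∈ S).card / ((planeTrees n).card ^ 2 : ℝ)

/-- The total variation distance between `nuT` and `nuP`. -/
noncomputable def tvDist (n : ℕ) : ℝ :=
  ((binTrees n ×ˢ binTrees n).powerset).sup' (Finset.powerset_nonempty _)
    fun S => |nuT n S - nuP n S|

/-- The number of occurrences of (trees isomorphic to) `B` as a fringe subtree of `T`. -/
def occ (B : PTree) : PTree → ℕ
  | leaf => if normalize leaf = normalize B then 1 else 0
  | node l r => (if normalize (node l r) = normalize B then 1 else 0) + occ B l + occ B r

/-- The number of generators of the automorphism group of `T`: the number of internal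
vertices whose two branches are isomorphic. -/
def gens : PTree → ℕ
  | leaf => 0
  | node l r => (if normalize l = normalize r then 1 else 0) + gens l + gens r

/-- `T` has a root branch isomorphic to `B`. -/
def hasBranch (B : PTree) : PTree → Prop
  | leaf => False
  | node l r => normalize l = normalize B ∨ normalize r = normalize B

/-- The cherries of a plane binary tree whose leaves are numbered from `k` on
(left to right), as pairs of leaf positions. -/
def cherryList : PTree → ℕ → List (ℕ × ℕ)
  | leaf, _ => []
  | node leaf leaf, k => [(k, k + 1)]
  | node l r, k => cherryList l k ++ cherryList r (k + l.size)

/-- The number of matched cherries: cherries of `T` whose two leaves are matched by `L`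
to the two leaves of a cherry of `S`. -/
def matchedCherries (T S : PTree) (L : List ℕ) : ℕ :=
  (cherryList T 0).countP fun p =>
    (cherryList S 0).any fun q =>
      (L.getD p.1 0 == q.1 && L.getD p.2 0 == q.2) ||
      (L.getD p.1 0 == q.2 && L.getD p.2 0 == q.1)

/-- The number of automorphisms of the tanglegram represented by the triple `(T, L, S)`:
pairs of automorphisms of the two trees compatible with the matching `L`. -/
def tangleAutCount (T S : PTree) (L : List ℕ) : ℕ :=
  ((isoFuns T T).map fun a =>
    (isoFuns S S).countP fun b =>
      (List.range T.size).all fun i => L.getD (a i) 0 == b (L.getD i 0)).sum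

/-- The number of automorphisms of `T` whose cycle type is `μ(s) = 2^s 1^(n-2s)`,
i.e. involutions of the leaves moving exactly `2 s` leaves. -/
def autMuCount (T : PTree) (s : ℕ) : ℕ :=
  (isoFuns T T).countP fun f =>
    ((List.range T.size).all fun i => f (f i) == i) &&
    ((List.range T.size).countP fun i => !(f i == i)) == 2 * s

end PTree

theorem two_mul_centralBinom_le_centralBinom_succ (n : ℕ) :
    2 * n.centralBinom ≤ (n + 1).centralBinom := by
  refine Nat.le_of_mul_le_mul_left ?_ n.succ_pos
  rw [Nat.succ_eq_add_one, Nat.succ_mul_centralBinom_succ]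
  nlinarith [Nat.zero_le (n * n.centralBinom)]

theorem two_pow_le_centralBinom (n : ℕ) : 2 ^ n ≤ n.centralBinom := by
  induction n with
  | zero => simp
  | succ n ih =>
    rw [pow_succ]
    linarith [two_mul_centralBinom_le_centralBinom_succ n]

theorem six_mul_two_pow_le_centralBinom_add_two (n : ℕ) :
    6 * 2 ^ n ≤ (n + 2).centralBinom := by
  induction n with
  | zero => simp [Nat.centralBinom, Nat.choose]
  | succ n ih =>
    rw [pow_succ, show n + 1 + 2 = n + 2 + 1 by rfl]
    linarith [two_mul_centralBinom_le_centralBinom_succ (n + 2)]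

theorem three_mul_two_pow_le_choose (n : ℕ) : 3 * 2 ^ n ≤ (2 * n + 3).choose (n + 1) := by
  have h := six_mul_two_pow_le_centralBinom_add_two n
  have hs : (2 * n + 3).choose (n + 2) = (2 * n + 3).choose (n + 1) :=
    Nat.choose_symm_of_eq_add (by omega)
  rw [Nat.centralBinom, show 2 * (n + 2) = 2 * n + 3 + 1 by ring, Nat.choose_succ_succ', hs] at h
  omega

theorem choose_mul_choose_le_add_choose (a b i j : ℕ) :
    a.choose i * b.choose j ≤ (a + b).choose (i + j) := by
  rw [Nat.add_choose_eq]
  exact Finset.single_le_sum (f := fun p : ℕ × ℕ => a.choose p.1 * b.choose p.2)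
    (fun _ _ => Nat.zero_le _) (Finset.HasAntidiagonal.mem_antidiagonal (a := (i, j)).2 rfl)

theorem choose_sq_add_choose_mul_choose_le (d n : ℕ) :
    (d + n + 1).choose (n + 1) ^ 2 + (d + n + 1).choose (n + 1) * (d + n + 1).choose n ≤
      (2 * d + 2 * n + 3).choose (2 * n + 2) := by
  have h := choose_mul_choose_le_add_choose (d + n + 1) (d + n + 1 + 1) (n + 1) (n + 1)
  rw [Nat.choose_succ_succ' (d + n + 1) n] at h
  convert h using 1
  · ring
  · congr 1 <;> ring

theorem two_pow_le_choose_mul_choose (e n : ℕ) (h : e + 1 ≤ n) :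
    2 ^ (2 * e + 3) ≤ (e + 1 + n + 1).choose (n + 1) * (e + 1 + n + 1).choose n := by
  have hA : 3 * 2 ^ e ≤ (e + 1 + n + 1).choose (n + 1) := by
    rw [Nat.choose_symm_of_eq_add (show e + 1 + n + 1 = n + 1 + (e + 1) by ring)]
    exact (three_mul_two_pow_le_choose e).trans (Nat.choose_le_choose _ (by omega))
  have hB : 3 * 2 ^ e ≤ (e + 1 + n + 1).choose n := by
    rw [Nat.choose_symm_of_eq_add (show e + 1 + n + 1 = n + (e + 2) by ring)]
    refine (three_mul_two_pow_le_choose e).trans ?_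
    rw [Nat.choose_symm_of_eq_add (show 2 * e + 3 = e + 1 + (e + 2) by ring)]
    exact Nat.choose_le_choose _ (by omega)
  calc 2 ^ (2 * e + 3) = 8 * (2 ^ e * 2 ^ e) := by ring
    _ ≤ 3 * 2 ^ e * (3 * 2 ^ e) := by nlinarith [Nat.zero_le (2 ^ e * 2 ^ e)]
    _ ≤ _ := Nat.mul_le_mul hA hB

/-- The combinatorial inequality used in the proof of Lemma 2: for positive integers
`c, t` with `2c ≤ t`, if `t` is even then
`binom(c + t/2 - 1, t/2)² + 2^(2c-1) ≤ binom(2c + t - 1, t)`,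
and if `t` is odd then `2^(2c-1) ≤ binom(2c + t - 1, t)`. -/
theorem choose_sq_add_two_pow_le_choose (c t : ℕ) (hc : 0 < c) (ht : 0 < t)
    (h : 2 * c ≤ t) :
    (Even t → Nat.choose (c + t / 2 - 1) (t / 2) ^ 2 + 2 ^ (2 * c - 1)
        ≤ Nat.choose (2 * c + t - 1) t) ∧
    (Odd t → 2 ^ (2 * c - 1) ≤ Nat.choose (2 * c + t - 1) t) := by
  constructor
  · rintro ⟨m, rfl⟩
    obtain ⟨n, rfl⟩ : ∃ n, m = n + 1 := ⟨m - 1, by omega⟩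
    obtain ⟨d, rfl⟩ : ∃ d, c = d + 1 := ⟨c - 1, by omega⟩
    rw [show (n + 1 + (n + 1)) / 2 = n + 1 by omega,
      show d + 1 + (n + 1) - 1 = d + n + 1 by omega,
      show 2 * (d + 1) + (n + 1 + (n + 1)) - 1 = 2 * d + 2 * n + 3 by omega,
      show n + 1 + (n + 1) = 2 * n + 2 by ring, show 2 * (d + 1) - 1 = 2 * d + 1 by omega]
    cases d with
    | zero => simp
    | succ e =>
      exact (Nat.add_le_add_left (two_pow_le_choose_mul_choose e n (by omega)) _).trans
        (choose_sq_add_choose_mul_choose_le (e + 1) n)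
  · intro _
    rw [Nat.choose_symm_of_eq_add (show 2 * c + t - 1 = t + (2 * c - 1) by omega)]
    exact (two_pow_le_centralBinom _).trans (Nat.choose_le_choose _ (by omega))
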